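/- arXiv:1403.5198 — 6 statements merged into one kernel-verified Lean document; each statement's English description precedes it below -/
import Mathlib

section
/- Consider the closed-loop system ẋ = −B B^T x − B η + E d̄, η̇ = B^T x (i.e., the closed-loop system with quadratic Hamiltonians H(x) = ½‖x‖², H_c(η) = ½‖η‖² and R = I) on a directed graph G with incidence matrix B. Then: (a) for every d̄ ∈ ℝ^k there exists η̄ ∈ ℝ^m with E d̄ = B η̄ if and only if im E ⊆ im B; (b) if im E ⊆ im B and G is weakly connected, then every globally defined solution (x(t), η(t)) converges as t → ∞ to an element of the load-balancing set E_tot = {(x, η) : x = α 1_n for some α ∈ ℝ, and B η = E d̄}. -/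
open Matrix Filter

/-- Incidence matrix of a directed graph with `n` vertices and `m` edges. -/
def incMat {n m : ℕ} (tail head : Fin m → Fin n) : Matrix (Fin n) (Fin m) ℝ :=
  Matrix.of fun i j => if head j = i then (1 : ℝ) else if tail j = i then -1 else 0

/-- Undirected adjacency. -/
def undirAdj {n m : ℕ} (tail head : Fin m → Fin n) (i j : Fin n) : Prop :=
  ∃ e : Fin m, (tail e = i ∧ head e = j) ∨ (tail e = j ∧ head e = i)

/-- Weak connectivity. -/
def WeaklyConnected {n m : ℕ} (tail head : Fin m → Fin n) : Prop :=
  ∀ i j : Fin n, Relation.ReflTransGen (undirAdj tail head) i j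

/-- Each column of `E` has exactly one nonzero entry, equal to `1` or `-1`. -/
def IsExtMat {n k : ℕ} (E : Matrix (Fin n) (Fin k) ℝ) : Prop :=
  ∀ j, ∃ i, (E i j = 1 ∨ E i j = -1) ∧ ∀ i', i' ≠ i → E i' j = 0

/-- Solutions of the damped oscillator `ẏ = −l y − z`, `ż = l y` with `l > 0` tend to zero. -/
lemma tendsto_zero_of_damped_oscillator {l : ℝ} (hl : 0 < l) {y z : ℝ → ℝ}
    (hy : ∀ t, HasDerivAt y (-l * y t - z t) t) (hz : ∀ t, HasDerivAt z (l * y t) t) :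
    Tendsto y atTop (nhds 0) ∧ Tendsto z atTop (nhds 0) := by
  set V : ℝ → ℝ := fun t => 2 * l * y t ^ 2 + 2 * l * (y t * z t) + (l + 2) * z t ^ 2 with hV
  have hVd : ∀ t, HasDerivAt V (-2 * l * (l * y t ^ 2 + z t ^ 2)) t := fun t => by
    have h := ((((hy t).pow 2).const_mul (2 * l)).add
      (((hy t).mul (hz t)).const_mul (2 * l))).add (((hz t).pow 2).const_mul (l + 2))
    refine h.congr_deriv ?_
    push_cast
    ring
  set c : ℝ := l / (l + 2) with hc
  have hcpos : 0 < c := by positivity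
  have hcl : c * (l + 2) = l := by rw [hc]; field_simp
  have hlower : ∀ t, l * y t ^ 2 + 2 * z t ^ 2 ≤ V t := fun t => by
    have := mul_nonneg hl.le (sq_nonneg (y t + z t))
    simp only [hV]
    nlinarith
  have hdecay : ∀ t, c * V t ≤ 2 * l * (l * y t ^ 2 + z t ^ 2) := fun t => by
    have h1 : V t ≤ (l + 2) * (2 * (l * y t ^ 2 + z t ^ 2)) := by
      have h2 := mul_nonneg hl.le (sq_nonneg (y t - z t))
      have h3 := mul_nonneg (mul_nonneg hl.le hl.le) (sq_nonneg (y t))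
      have h4 := mul_nonneg hl.le (sq_nonneg (y t))
      simp only [hV]
      nlinarith [sq_nonneg (z t)]
    calc c * V t ≤ c * ((l + 2) * (2 * (l * y t ^ 2 + z t ^ 2))) := by gcongr
      _ = c * (l + 2) * (2 * (l * y t ^ 2 + z t ^ 2)) := by ring
      _ = _ := by rw [hcl]; ring
  have hWd : ∀ t, HasDerivAt (fun t => Real.exp (c * t) * V t)
      (Real.exp (c * t) * (c * V t - 2 * l * (l * y t ^ 2 + z t ^ 2))) t := fun t => by
    have h := (((hasDerivAt_id t).const_mul c).exp).mul (hVd t)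
    refine h.congr_deriv ?_
    simp only [id]
    ring
  have hanti : Antitone (fun t => Real.exp (c * t) * V t) :=
    antitone_of_hasDerivAt_nonpos hWd fun t =>
      mul_nonpos_of_nonneg_of_nonpos (Real.exp_pos _).le (by linarith [hdecay t])
  have hbound : ∀ t, 0 ≤ t → V t ≤ V 0 * Real.exp (-(c * t)) := fun t ht => by
    have h := hanti ht
    simp only [mul_zero, Real.exp_zero, one_mul] at h
    rw [Real.exp_neg, ← div_eq_mul_inv, le_div_iff₀ (Real.exp_pos _)]
    linarith
  have hexp : Tendsto (fun t : ℝ => V 0 * Real.exp (-(c * t))) atTop (nhds 0) := by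
    have h := (Real.tendsto_exp_neg_atTop_nhds_zero.comp
      (tendsto_id.const_mul_atTop hcpos)).const_mul (V 0)
    simpa [Function.comp_def] using h
  have hVnonneg : ∀ t, 0 ≤ V t := fun t => le_trans (by positivity) (hlower t)
  have hV0 : Tendsto V atTop (nhds 0) :=
    tendsto_of_tendsto_of_tendsto_of_le_of_le' tendsto_const_nhds hexp
      (Eventually.of_forall hVnonneg) ((eventually_ge_atTop 0).mono hbound)
  have tendsto_of_sq_le : ∀ {f : ℝ → ℝ} {a : ℝ}, 0 < a → (∀ t, a * f t ^ 2 ≤ V t) →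
      Tendsto f atTop (nhds 0) := fun {f a} ha h => by
    have hsq : Tendsto (fun t => f t ^ 2) atTop (nhds 0) := by
      refine squeeze_zero (fun t => sq_nonneg _) (fun t => ?_)
        (by simpa using hV0.div_const a)
      rw [le_div_iff₀ ha]
      linarith [h t]
    rw [tendsto_zero_iff_abs_tendsto_zero]
    simpa [Function.comp_def, Real.sqrt_sq_eq_abs] using hsq.sqrt
  exact ⟨tendsto_of_sq_le hl fun t => by nlinarith [hlower t, sq_nonneg (z t)],
    tendsto_of_sq_le two_pos fun t => by nlinarith [hlower t, mul_nonneg hl.le (sq_nonneg (y t))]⟩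

/-- Spectral decomposition of the Gram matrix `B Bᵀ`, in terms of dot products. -/
lemma exists_eigenbasis_mul_transpose {n m : ℕ} (B : Matrix (Fin n) (Fin m) ℝ) :
    ∃ (v : Fin n → Fin n → ℝ) (l : Fin n → ℝ), (∀ i, 0 ≤ l i) ∧
      (∀ i, (B * Bᵀ) *ᵥ v i = l i • v i) ∧ ∀ w, w = ∑ i, (v i ⬝ᵥ w) • v i := by
  have hpsd : (B * Bᵀ).PosSemidef := by
    simpa using Matrix.posSemidef_self_mul_conjTranspose B
  refine ⟨fun i => hpsd.1.eigenvectorBasis i, hpsd.1.eigenvalues, hpsd.eigenvalues_nonneg,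
    fun i => hpsd.1.mulVec_eigenvectorBasis i, fun w => ?_⟩
  have h := congrArg WithLp.ofLp (hpsd.1.eigenvectorBasis.sum_repr' (WithLp.toLp 2 w))
  simp only [WithLp.ofLp_sum, WithLp.ofLp_smul, EuclideanSpace.inner_eq_star_dotProduct,
    star_trivial] at h
  rw [← h]
  exact Finset.sum_congr rfl fun i _ => by rw [dotProduct_comm, h]

lemma transpose_mulVec_eq_zero_of_mul_transpose_mulVec {n m : ℕ} {B : Matrix (Fin n) (Fin m) ℝ}
    {v : Fin n → ℝ} (h : (B * Bᵀ) *ᵥ v = 0) : Bᵀ *ᵥ v = 0 := by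
  rw [← dotProduct_self_eq_zero, mulVec_transpose, ← dotProduct_mulVec, ← mulVec_transpose,
    mulVec_mulVec, h, dotProduct_zero]

lemma HasDerivAt.dotProduct_const_left {n : ℕ} {f : ℝ → Fin n → ℝ} {f' : Fin n → ℝ} {t : ℝ}
    (hf : HasDerivAt f f' t) (v : Fin n → ℝ) :
    HasDerivAt (fun s => v ⬝ᵥ f s) (v ⬝ᵥ f') t := by
  simp only [dotProduct]
  exact HasDerivAt.fun_sum fun i _ => (hasDerivAt_pi.1 hf i).const_mul (v i)

/-- Solutions of `ẋ = −B Bᵀ x − B ζ`, `ζ̇ = Bᵀ x` converge to an equilibrium. -/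
lemma exists_tendsto_equilibrium {n m : ℕ} (B : Matrix (Fin n) (Fin m) ℝ)
    {x : ℝ → Fin n → ℝ} {ζ : ℝ → Fin m → ℝ}
    (hx : ∀ t, HasDerivAt x (-((B * Bᵀ) *ᵥ x t) - B *ᵥ ζ t) t)
    (hζ : ∀ t, HasDerivAt ζ (Bᵀ *ᵥ x t) t) :
    ∃ xs ζs, Bᵀ *ᵥ xs = 0 ∧ B *ᵥ ζs = 0 ∧
      Tendsto x atTop (nhds xs) ∧ Tendsto ζ atTop (nhds ζs) := by
  obtain ⟨v, l, hl, hv, hrep⟩ := exists_eigenbasis_mul_transpose B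
  set y : Fin n → ℝ → ℝ := fun i t => v i ⬝ᵥ x t with hy
  set z : Fin n → ℝ → ℝ := fun i t => (Bᵀ *ᵥ v i) ⬝ᵥ ζ t with hz
  have hsymm : ∀ i w, v i ⬝ᵥ ((B * Bᵀ) *ᵥ w) = l i * (v i ⬝ᵥ w) := fun i w => by
    rw [dotProduct_mulVec, ← mulVec_transpose, transpose_mul, transpose_transpose, hv,
      smul_dotProduct, smul_eq_mul]
  have hyd : ∀ i t, HasDerivAt (y i) (-l i * y i t - z i t) t := fun i t => by
    refine ((hx t).dotProduct_const_left (v i)).congr_deriv ?_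
    rw [dotProduct_sub, dotProduct_neg, hsymm, dotProduct_mulVec, ← mulVec_transpose]
    simp only [hy, hz]
    ring
  have hzd : ∀ i t, HasDerivAt (z i) (l i * y i t) t := fun i t => by
    refine ((hζ t).dotProduct_const_left (Bᵀ *ᵥ v i)).congr_deriv ?_
    rw [mulVec_transpose, ← dotProduct_mulVec, mulVec_mulVec, hsymm]
  have hker : ∀ i, l i = 0 → Bᵀ *ᵥ v i = 0 := fun i hi =>
    transpose_mulVec_eq_zero_of_mul_transpose_mulVec (by rw [hv, hi, zero_smul])
  have hlim : ∀ i, 0 < l i → Tendsto (y i) atTop (nhds 0) ∧ Tendsto (z i) atTop (nhds 0) :=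
    fun i hi => tendsto_zero_of_damped_oscillator hi (hyd i) (hzd i)
  have hylim : ∀ i, ∃ a, Tendsto (y i) atTop (nhds a) ∧ a • (Bᵀ *ᵥ v i) = 0 := fun i => by
    rcases (hl i).eq_or_lt with hi | hi
    · refine ⟨y i 0, ?_, by rw [hker i hi.symm, smul_zero]⟩
      have hconst : ∀ t, y i t = y i 0 := fun t =>
        is_const_of_deriv_eq_zero (fun s => (hyd i s).differentiableAt)
          (fun s => by rw [(hyd i s).deriv]; simp [hz, ← hi, hker i hi.symm]) t 0
      exact tendsto_const_nhds.congr fun t => (hconst t).symm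
    · exact ⟨0, (hlim i hi).1, zero_smul _ _⟩
  have hzlim : ∀ i, Tendsto (z i) atTop (nhds 0) := fun i => by
    rcases (hl i).eq_or_lt with hi | hi
    · simp [hz, hker i hi.symm]
    · exact (hlim i hi).2
  choose a ha haB using hylim
  -- `∑ i, (z i / l i) Bᵀ v i` is a primitive of `Bᵀ x`, so it differs from `ζ` by a constant.
  set p : ℝ → Fin m → ℝ := fun t => ∑ i, (z i t / l i) • (Bᵀ *ᵥ v i) with hp
  have hpd : ∀ t, HasDerivAt p (Bᵀ *ᵥ x t) t := fun t => by
    have h : HasDerivAt p (∑ i, (l i * y i t / l i) • (Bᵀ *ᵥ v i)) t :=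
      HasDerivAt.fun_sum fun i _ => ((hzd i t).div_const (l i)).smul_const _
    refine h.congr_deriv ?_
    conv_rhs => rw [hrep (x t), mulVec_sum]
    refine Finset.sum_congr rfl fun i _ => ?_
    rw [mulVec_smul]
    by_cases hi : l i = 0
    · rw [hker i hi, smul_zero, smul_zero]
    · rw [mul_div_cancel_left₀ _ hi]
  have hconst : ∀ t, ζ t = (ζ 0 - p 0) + p t := fun t => by
    have hd : ∀ s, HasDerivAt (fun s => ζ s - p s) 0 s := fun s =>
      ((hζ s).sub (hpd s)).congr_deriv (sub_self _)
    have h := is_const_of_deriv_eq_zero (fun s => (hd s).differentiableAt)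
      (fun s => (hd s).deriv) t 0
    rw [← h]
    simp
  have hplim : Tendsto p atTop (nhds 0) := by
    have h := tendsto_finsetSum Finset.univ fun i _ =>
      ((hzlim i).div_const (l i)).smul_const (Bᵀ *ᵥ v i)
    simpa using h
  have hζlim : Tendsto ζ atTop (nhds (ζ 0 - p 0)) := by
    have h := hplim.const_add (ζ 0 - p 0)
    rw [add_zero] at h
    exact h.congr fun t => (hconst t).symm
  refine ⟨∑ i, a i • v i, ζ 0 - p 0, ?_, ?_, ?_, hζlim⟩
  · simp only [mulVec_sum, mulVec_smul, haB, Finset.sum_const_zero]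
  · rw [hrep (B *ᵥ (ζ 0 - p 0))]
    refine Finset.sum_eq_zero fun i _ => ?_
    have h : Tendsto (z i) atTop (nhds ((Bᵀ *ᵥ v i) ⬝ᵥ (ζ 0 - p 0))) :=
      ((continuous_const.dotProduct continuous_id).tendsto _).comp hζlim
    rw [dotProduct_mulVec, ← mulVec_transpose, tendsto_nhds_unique h (hzlim i), zero_smul]
  · exact (tendsto_finsetSum Finset.univ fun i _ => (ha i).smul_const (v i)).congr
      fun t => (hrep (x t)).symm

lemma transpose_incMat_mulVec {n m : ℕ} {tail head : Fin m → Fin n}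
    (hloop : ∀ e, tail e ≠ head e) (x : Fin n → ℝ) (e : Fin m) :
    ((incMat tail head)ᵀ *ᵥ x) e = x (head e) - x (tail e) := by
  have h : ∀ i, (incMat tail head)ᵀ e i * x i =
      (if head e = i then x i else 0) - (if tail e = i then x i else 0) := fun i => by
    have := hloop e
    simp only [incMat, transpose_apply, of_apply]
    split_ifs <;> simp_all
  simp only [mulVec, dotProduct, h, Finset.sum_sub_distrib, Finset.sum_ite_eq, Finset.mem_univ,
    if_true]

lemma WeaklyConnected.eq_const_of_transpose_incMat_mulVec_eq_zero {n m : ℕ}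
    {tail head : Fin m → Fin n} (hconn : WeaklyConnected tail head)
    (hloop : ∀ e, tail e ≠ head e) {x : Fin n → ℝ} (hx : (incMat tail head)ᵀ *ᵥ x = 0) :
    ∃ α : ℝ, x = fun _ => α := by
  have hedge : ∀ e, x (head e) = x (tail e) := fun e => by
    rw [← sub_eq_zero, ← transpose_incMat_mulVec hloop, hx, Pi.zero_apply]
  have hpath : ∀ i j, x i = x j := fun i j => by
    induction hconn i j with
    | refl => rfl
    | tail _ hadj ih =>
      obtain ⟨e, ⟨rfl, rfl⟩ | ⟨rfl, rfl⟩⟩ := hadj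
      · rw [ih, hedge]
      · rw [ih, hedge]
  rcases isEmpty_or_nonempty (Fin n) with _ | ⟨⟨i⟩⟩
  · exact ⟨0, Subsingleton.elim _ _⟩
  · exact ⟨x i, funext fun j => hpath j i⟩

/-- For the closed-loop system with quadratic Hamiltonians `ẋ = −B Bᵀ x − B η + E d̄`,
`η̇ = Bᵀ x`:  (a) the matching condition is solvable for every `d̄` iff `im E ⊆ im B`;
(b) if `im E ⊆ im B` and the graph is weakly connected, every globally defined solution
converges to an element of the load-balancing set. -/
theorem quadratic_closedLoop_matching_and_convergence
    {n m k : ℕ} (tail head : Fin m → Fin n) (hloop : ∀ e, tail e ≠ head e)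
    (E : Matrix (Fin n) (Fin k) ℝ) (hE : IsExtMat E) :
    ((∀ d : Fin k → ℝ, ∃ ηbar : Fin m → ℝ,
        E.mulVec d = (incMat tail head).mulVec ηbar) ↔
      LinearMap.range E.mulVecLin ≤ LinearMap.range (incMat tail head).mulVecLin) ∧
    (LinearMap.range E.mulVecLin ≤ LinearMap.range (incMat tail head).mulVecLin →
      WeaklyConnected tail head →
      ∀ (d : Fin k → ℝ) (x : ℝ → Fin n → ℝ) (η : ℝ → Fin m → ℝ),
        (∀ t, HasDerivAt x
          (-(incMat tail head * (incMat tail head)ᵀ).mulVec (x t)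
            - (incMat tail head).mulVec (η t) + E.mulVec d) t) →
        (∀ t, HasDerivAt η ((incMat tail head)ᵀ.mulVec (x t)) t) →
        ∃ (xs : Fin n → ℝ) (ηs : Fin m → ℝ),
          (∃ α : ℝ, xs = fun _ => α) ∧
          (incMat tail head).mulVec ηs = E.mulVec d ∧
          Tendsto (fun t => (x t, η t)) atTop (nhds (xs, ηs))) := by
  refine ⟨⟨?_, ?_⟩, fun hrange hconn d x η hx hη => ?_⟩
  · rintro h _ ⟨d, rfl⟩
    obtain ⟨ηbar, hηbar⟩ := h d
    exact ⟨ηbar, hηbar.symm⟩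
  · intro h d
    obtain ⟨ηbar, hηbar⟩ := h ⟨d, rfl⟩
    exact ⟨ηbar, hηbar.symm⟩
  · obtain ⟨ηbar, hηbar⟩ := hrange ⟨d, rfl⟩
    simp only [mulVecLin_apply] at hηbar
    obtain ⟨xs, ζs, hxs, hζs, hxlim, hζlim⟩ :=
      exists_tendsto_equilibrium (incMat tail head) (x := x) (ζ := fun t => η t - ηbar)
        (fun t => (hx t).congr_deriv (by rw [mulVec_sub, hηbar]; abel))
        (fun t => (hη t).sub_const ηbar)
    refine ⟨xs, ζs + ηbar, hconn.eq_const_of_transpose_incMat_mulVec_eq_zero hloop hxs,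
      by rw [mulVec_add, hζs, hηbar, zero_add], hxlim.prodMk_nhds ?_⟩
    simpa using hζlim.add_const ηbar
end

section
/- Consider the proportionally controlled system ẋ = −B R B^T ∇H(x) on a directed graph G with incidence matrix B, where H(x) = Σ_{i=1}^n H_i(x_i) with each H_i : ℝ → ℝ twice continuously differentiable and convex, and R is a diagonal m×m matrix with strictly positive diagonal entries. If a continuously differentiable solution x(t) satisfies ∇H(x(0)) ≥ 0 componentwise, then ∇H(x(t)) ≥ 0 componentwise for all t ≥ 0. -/
open Matrix

/-- `R` is diagonal with strictly positive diagonal entries. -/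
def IsPosDiag {m : ℕ} (R : Matrix (Fin m) (Fin m) ℝ) : Prop :=
  (∀ i j, i ≠ j → R i j = 0) ∧ ∀ i, 0 < R i i

/-- The square of the negative part is differentiable. -/
theorem hasDerivAt_min_zero_sq (z : ℝ) :
    HasDerivAt (fun y : ℝ => (min y 0) ^ 2) (2 * min z 0) z := by
  have hsq : HasDerivAt (fun y : ℝ => y ^ 2) (2 * z) z := by
    simpa using hasDerivAt_pow 2 z
  rcases lt_trichotomy z 0 with h | h | h
  · rw [min_eq_left h.le]
    refine hsq.congr_of_eventuallyEq ?_
    filter_upwards [Iio_mem_nhds h] with y hy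
    rw [min_eq_left (le_of_lt hy)]
  · subst h
    have hl : HasDerivWithinAt (fun y : ℝ => (min y 0) ^ 2) (2 * min 0 0) (Set.Iic 0) 0 := by
      rw [min_self]
      refine hsq.hasDerivWithinAt.congr (fun y hy => ?_) (by simp)
      rw [min_eq_left hy]
    have hr : HasDerivWithinAt (fun y : ℝ => (min y 0) ^ 2) (2 * min 0 0) (Set.Ici 0) 0 := by
      rw [min_self, mul_zero]
      refine (hasDerivWithinAt_const 0 _ (0 : ℝ)).congr (fun y hy => ?_) (by simp)
      rw [min_eq_right hy]
      norm_num
    have hu := hl.union hr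
    rwa [Set.Iic_union_Ici, hasDerivWithinAt_univ] at hu
  · rw [min_eq_right h.le, mul_zero]
    refine (hasDerivAt_const z (0 : ℝ)).congr_of_eventuallyEq ?_
    filter_upwards [Ioi_mem_nhds h] with y hy
    rw [min_eq_right (le_of_lt hy)]
    norm_num

/-- A weighted Laplacian acts as a sum over edges of weighted differences. -/
theorem incMat_laplacian_mulVec {n m : ℕ} (tail head : Fin m → Fin n)
    (hloop : ∀ e, tail e ≠ head e) (R : Matrix (Fin m) (Fin m) ℝ) (hR : IsPosDiag R)
    (z : Fin n → ℝ) (i : Fin n) :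
    ((incMat tail head * R * (incMat tail head)ᵀ).mulVec z) i =
      ∑ e, incMat tail head i e * (R e e * (z (head e) - z (tail e))) := by
  have hdiag : R = Matrix.diagonal fun e => R e e := by
    ext a b
    by_cases h : a = b
    · subst h; simp
    · rw [Matrix.diagonal_apply_ne _ h, hR.1 a b h]
  have hdiff (e : Fin m) : ((incMat tail head)ᵀ *ᵥ z) e = z (head e) - z (tail e) := by
    have hentry (k : Fin n) : (incMat tail head) k e * z k =
        (if head e = k then z k else 0) - (if tail e = k then z k else 0) := by
      have := hloop e
      simp only [incMat, Matrix.of_apply]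
      split_ifs with h₁ h₂
      · exact absurd (h₂.trans h₁.symm) this
      all_goals ring
    simp only [Matrix.mulVec, dotProduct, Matrix.transpose_apply, hentry,
      Finset.sum_sub_distrib, Finset.sum_ite_eq, Finset.mem_univ, if_true]
  rw [← Matrix.mulVec_mulVec, ← Matrix.mulVec_mulVec]
  have hscale : R *ᵥ ((incMat tail head)ᵀ *ᵥ z) =
      fun e => R e e * (z (head e) - z (tail e)) := by
    funext e
    conv_lhs => rw [hdiag]
    rw [Matrix.mulVec_diagonal, hdiff]
  rw [hscale]
  rfl

theorem min_zero_mul_sub_le (a b : ℝ) : min a 0 * (b - a) ≤ (min b 0) ^ 2 := by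
  rcases le_total a 0 with ha | ha <;> rcases le_total b 0 with hb | hb <;>
    simp only [ha, hb, min_eq_left, min_eq_right] <;>
    nlinarith [sq_nonneg (a - b), sq_nonneg a, sq_nonneg b]

/-- The Laplacian flow moves the negative part of a vector by at most a multiple of the
energy of the negative part. -/
theorem min_zero_mul_neg_laplacian_le {n m : ℕ} (tail head : Fin m → Fin n)
    (hloop : ∀ e, tail e ≠ head e) (R : Matrix (Fin m) (Fin m) ℝ) (hR : IsPosDiag R)
    (z : Fin n → ℝ) (i : Fin n) :
    min (z i) 0 * -((incMat tail head * R * (incMat tail head)ᵀ).mulVec z) i ≤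
      (∑ e, R e e) * ∑ k, (min (z k) 0) ^ 2 := by
  rw [incMat_laplacian_mulVec tail head hloop R hR, ← Finset.sum_neg_distrib, Finset.mul_sum,
    Finset.sum_mul]
  refine Finset.sum_le_sum fun e _ => ?_
  have hr := (hR.2 e).le
  have hle (k : Fin n) : (min (z k) 0) ^ 2 ≤ ∑ k, (min (z k) 0) ^ 2 :=
    Finset.single_le_sum (f := fun k => (min (z k) 0) ^ 2) (fun k _ => sq_nonneg _)
      (Finset.mem_univ k)
  simp only [incMat, Matrix.of_apply]
  split_ifs with h₁ h₂
  · rw [h₁]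
    calc _ = R e e * (min (z i) 0 * (z (tail e) - z i)) := by ring
      _ ≤ _ := mul_le_mul_of_nonneg_left ((min_zero_mul_sub_le _ _).trans (hle _)) hr
  · rw [h₂]
    calc _ = R e e * (min (z i) 0 * (z (head e) - z i)) := by ring
      _ ≤ _ := mul_le_mul_of_nonneg_left ((min_zero_mul_sub_le _ _).trans (hle _)) hr
  · simpa using mul_nonneg hr ((sq_nonneg _).trans (hle i))

/-- Grönwall's inequality for a nonnegative function vanishing at the left endpoint. -/
theorem eq_zero_of_hasDerivAt_le_mul {V V' : ℝ → ℝ} {K T : ℝ} (hT : 0 ≤ T)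
    (hV : ∀ t, HasDerivAt V (V' t) t) (hnonneg : 0 ≤ V T) (hzero : V 0 = 0)
    (hle : ∀ t ∈ Set.Icc 0 T, V' t ≤ K * V t) : V T = 0 := by
  have hd (t : ℝ) : HasDerivAt (fun s => V s * Real.exp (-(K * s)))
      (V' t * Real.exp (-(K * t)) + V t * (Real.exp (-(K * t)) * -(K * 1))) t :=
    (hV t).mul (((hasDerivAt_id t).const_mul K).neg.exp)
  have hanti : AntitoneOn (fun s => V s * Real.exp (-(K * s))) (Set.Icc 0 T) := by
    refine antitoneOn_of_deriv_nonpos (convex_Icc 0 T)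
      (fun t _ => (hd t).continuousAt.continuousWithinAt)
      (fun t _ => (hd t).differentiableAt.differentiableWithinAt) fun t ht => ?_
    rw [(hd t).deriv]
    nlinarith [hle t (interior_subset ht), Real.exp_pos (-(K * t))]
  have h := hanti (Set.left_mem_Icc.2 hT) (Set.right_mem_Icc.2 hT) hT
  simp only [hzero, zero_mul] at h
  exact le_antisymm (nonpos_of_mul_nonpos_left h (Real.exp_pos _)) hnonneg

/-- For the proportionally controlled system `ẋ = −B R Bᵀ ∇H(x)` with separable convex `H`,
the set where the output `∇H(x)` is componentwise nonnegative is invariant. -/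
theorem proportional_control_preserves_nonneg_output
    {n m : ℕ} (tail head : Fin m → Fin n) (hloop : ∀ e, tail e ≠ head e)
    (R : Matrix (Fin m) (Fin m) ℝ) (hR : IsPosDiag R)
    (Hi : Fin n → ℝ → ℝ) (hHi : ∀ i, ContDiff ℝ 2 (Hi i))
    (hconv : ∀ i, ConvexOn ℝ Set.univ (Hi i))
    (x : ℝ → Fin n → ℝ)
    (hx : ∀ t, HasDerivAt x
      (-(incMat tail head * R * (incMat tail head)ᵀ).mulVec
        (fun i => deriv (Hi i) (x t i))) t)
    (h0 : ∀ i, 0 ≤ deriv (Hi i) (x 0 i)) :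
    ∀ t : ℝ, 0 ≤ t → ∀ i, 0 ≤ deriv (Hi i) (x t i) := by
  intro T hT
  have hC1 (i : Fin n) : ContDiff ℝ 1 (deriv (Hi i)) := (contDiff_succ_iff_deriv.1 (hHi i)).2.2
  have hd_nonneg (i : Fin n) (y : ℝ) : 0 ≤ deriv (deriv (Hi i)) y := by
    have hmono : Monotone (deriv (Hi i)) := by
      have := (hconv i).monotoneOn_deriv
        fun y _ => ((hHi i).differentiable (by norm_num)).differentiableAt
      rwa [monotoneOn_univ] at this
    exact hmono.deriv_nonneg
  have hx_apply (i : Fin n) (t : ℝ) := hasDerivAt_pi.1 (hx t) i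
  have hx_cont (i : Fin n) : Continuous fun t => x t i :=
    continuous_iff_continuousAt.2 fun t => (hx_apply i t).continuousAt
  set L := incMat tail head * R * (incMat tail head)ᵀ
  set z : ℝ → Fin n → ℝ := fun t i => deriv (Hi i) (x t i)
  set d : ℝ → Fin n → ℝ := fun t i => deriv (deriv (Hi i)) (x t i)
  have hz_deriv (i : Fin n) (t : ℝ) :
      HasDerivAt (fun s => z s i) (d t i * -(L.mulVec (z t)) i) t :=
    HasDerivAt.comp t
      (((hC1 i).differentiable (by norm_num)).differentiableAt.hasDerivAt) (hx_apply i t)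
  have hV_deriv (t : ℝ) : HasDerivAt (fun s => ∑ i, (min (z s i) 0) ^ 2)
      (∑ i, 2 * min (z t i) 0 * (d t i * -(L.mulVec (z t)) i)) t :=
    HasDerivAt.fun_sum fun i _ =>
      HasDerivAt.comp (h₂ := fun y : ℝ => (min y 0) ^ 2) t (hasDerivAt_min_zero_sq (z t i))
        (hz_deriv i t)
  have hd_cont : Continuous fun t => ∑ i, d t i :=
    continuous_finsetSum _ fun i _ => ((hC1 i).continuous_deriv le_rfl).comp (hx_cont i)
  obtain ⟨C, hC⟩ := (isCompact_Icc (a := 0) (b := T)).bddAbove_image hd_cont.continuousOn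
  have hr : 0 ≤ ∑ e, R e e := Finset.sum_nonneg fun e _ => (hR.2 e).le
  have hV_nonneg (t : ℝ) : 0 ≤ ∑ i, (min (z t i) 0) ^ 2 :=
    Finset.sum_nonneg fun i _ => sq_nonneg _
  have hV_zero : ∑ i, (min (z T i) 0) ^ 2 = 0 := by
    refine eq_zero_of_hasDerivAt_le_mul (K := 2 * C * ∑ e, R e e) hT hV_deriv (hV_nonneg T) ?_ ?_
    · exact Finset.sum_eq_zero fun i _ => by rw [min_eq_right (h0 i)]; norm_num
    · intro t ht
      calc ∑ i, 2 * min (z t i) 0 * (d t i * -(L.mulVec (z t)) i)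
          ≤ ∑ i, 2 * d t i * ((∑ e, R e e) * ∑ k, (min (z t k) 0) ^ 2) := by
            refine Finset.sum_le_sum fun i _ => ?_
            have h := mul_le_mul_of_nonneg_left
              (min_zero_mul_neg_laplacian_le tail head hloop R hR (z t) i)
              (mul_nonneg zero_le_two (hd_nonneg i (x t i)))
            refine le_trans (le_of_eq ?_) h
            ring
        _ = 2 * (∑ i, d t i) * ((∑ e, R e e) * ∑ k, (min (z t k) 0) ^ 2) := by
            rw [← Finset.sum_mul, ← Finset.mul_sum]
        _ ≤ 2 * C * ((∑ e, R e e) * ∑ k, (min (z t k) 0) ^ 2) :=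
            mul_le_mul_of_nonneg_right
              (mul_le_mul_of_nonneg_left (hC (Set.mem_image_of_mem _ ht)) zero_le_two)
              (mul_nonneg hr (hV_nonneg t))
        _ = _ := by ring
  intro i
  have h := (Finset.sum_eq_zero_iff_of_nonneg fun i _ => sq_nonneg _).1 hV_zero i
    (Finset.mem_univ i)
  exact min_eq_right_iff.1 (pow_eq_zero_iff two_ne_zero |>.1 h)
end

section
/- (Filippov product rule) Let X₁ : ℝ^d → ℝ^p and X₂ : ℝ^d → ℝ^q be locally bounded at x ∈ ℝ^d. Then F[(X₁, X₂)](x) ⊆ F[X₁](x) × F[X₂](x), where (X₁, X₂) : ℝ^d → ℝ^{p+q} denotes the pair map. Moreover, if X₁ or X₂ is continuous at x, then equality holds. -/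
open MeasureTheory

/-- The Filippov set-valued map of `X` at `x`: the intersection over `δ > 0` and
Lebesgue-null sets `S` of the closed convex hulls of the images `X(B(x, δ) \ S)`. -/
def filippov {α E : Type*} [MeasureSpace α] [PseudoMetricSpace α]
    [AddCommGroup E] [Module ℝ E] [TopologicalSpace E]
    (X : α → E) (x : α) : Set E :=
  ⋂ (δ : ℝ) (_ : 0 < δ) (S : Set α) (_ : volume S = 0),
    closure (convexHull ℝ (X '' (Metric.ball x δ \ S)))

/-- `X` is locally bounded at `x`: bounded on some neighborhood of `x`. -/
def LocBddAt {α E : Type*} [PseudoMetricSpace α] [Norm E] (X : α → E) (x : α) : Prop :=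
  ∃ δ > 0, ∃ C : ℝ, ∀ y ∈ Metric.ball x δ, ‖X y‖ ≤ C

theorem map_mem_filippov {α E F : Type*} [MeasureSpace α] [PseudoMetricSpace α]
    [AddCommGroup E] [Module ℝ E] [TopologicalSpace E]
    [AddCommGroup F] [Module ℝ F] [TopologicalSpace F]
    (L : E →L[ℝ] F) {X : α → E} {Y : α → F} (hY : ∀ y, L (X y) = Y y) {x : α} {v : E} {w : F}
    (hw : L v = w) (hv : v ∈ filippov X x) : w ∈ filippov Y x := by
  subst hw
  obtain rfl : (fun y => L (X y)) = Y := funext hY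
  simp only [filippov, Set.mem_iInter] at hv ⊢
  intro δ hδ S hS
  have h := image_closure_subset_closure_image L.continuous
    (Set.mem_image_of_mem L (hv δ hδ S hS))
  have hconv := L.toLinearMap.image_convexHull (X '' (Metric.ball x δ \ S))
  rw [ContinuousLinearMap.coe_coe] at hconv
  rwa [hconv, Set.image_image] at h

theorem filippov_prodMk_subset {α E F : Type*} [MeasureSpace α] [PseudoMetricSpace α]
    [AddCommGroup E] [Module ℝ E] [TopologicalSpace E]
    [AddCommGroup F] [Module ℝ F] [TopologicalSpace F]
    (X : α → E) (Y : α → F) (x : α) :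
    filippov (fun y => (X y, Y y)) x ⊆ filippov X x ×ˢ filippov Y x := by
  intro v hv
  have hX : v.1 ∈ filippov X x :=
    map_mem_filippov (X := fun y => (X y, Y y)) (ContinuousLinearMap.fst ℝ E F)
      (fun _ => rfl) rfl hv
  have hY : v.2 ∈ filippov Y x :=
    map_mem_filippov (X := fun y => (X y, Y y)) (ContinuousLinearMap.snd ℝ E F)
      (fun _ => rfl) rfl hv
  exact Set.mem_prod.mpr ⟨hX, hY⟩

theorem ContinuousAt.exists_convexHull_image_ball_subset {α E : Type*} [PseudoMetricSpace α]
    [SeminormedAddCommGroup E] [NormedSpace ℝ E] {X : α → E} {x : α} (hX : ContinuousAt X x)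
    {ε : ℝ} (hε : 0 < ε) :
    ∃ δ > 0, convexHull ℝ (X '' Metric.ball x δ) ⊆ Metric.closedBall (X x) ε := by
  obtain ⟨δ, hδ, h⟩ := Metric.continuousAt_iff.mp hX ε hε
  refine ⟨δ, hδ, convexHull_min ?_ (convex_closedBall _ _)⟩
  rintro _ ⟨y, hy, rfl⟩
  exact (h hy).le

theorem ContinuousAt.filippov_subset_singleton {α E : Type*} [MeasureSpace α]
    [PseudoMetricSpace α] [NormedAddCommGroup E] [NormedSpace ℝ E] {X : α → E} {x : α}
    (hX : ContinuousAt X x) : filippov X x ⊆ {X x} := by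
  intro v hv
  simp only [filippov, Set.mem_iInter] at hv
  refine dist_le_zero.mp (le_of_forall_pos_le_add fun ε hε => ?_)
  obtain ⟨δ, hδ, h⟩ := hX.exists_convexHull_image_ball_subset hε
  have hmem := hv δ hδ ∅ measure_empty
  rw [Set.sdiff_empty] at hmem
  simpa using closure_minimal h Metric.isClosed_closedBall hmem

theorem ContinuousAt.prod_filippov_subset {α E F : Type*} [MeasureSpace α]
    [PseudoMetricSpace α] [NormedAddCommGroup E] [NormedSpace ℝ E]
    [SeminormedAddCommGroup F] [NormedSpace ℝ F] {X : α → E} {x : α}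
    (hX : ContinuousAt X x) (Y : α → F) :
    filippov X x ×ˢ filippov Y x ⊆ filippov (fun y => (X y, Y y)) x := by
  rintro ⟨v, w⟩ ⟨hv, hw⟩
  obtain rfl : v = X x := hX.filippov_subset_singleton hv
  simp only [filippov, Set.mem_iInter] at hw ⊢
  intro δ hδ S hS
  refine Metric.mem_closure_iff.mpr fun ε hε => ?_
  obtain ⟨η, hη, h⟩ := hX.exists_convexHull_image_ball_subset (half_pos hε)
  obtain ⟨b, hb, hwb⟩ := Metric.mem_closure_iff.mp (hw (min δ η) (lt_min hδ hη) S hS) ε hε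
  set A := Metric.ball x (min δ η) \ S
  have hsnd := (LinearMap.snd ℝ E F).image_convexHull ((fun y => (X y, Y y)) '' A)
  have hfst := (LinearMap.fst ℝ E F).image_convexHull ((fun y => (X y, Y y)) '' A)
  rw [Set.image_image] at hsnd hfst
  obtain ⟨u, hu, rfl⟩ := hsnd.symm.subset hb
  have hA : A ⊆ Metric.ball x δ \ S :=
    Set.sdiff_subset_sdiff_left (Metric.ball_subset_ball (min_le_left _ _))
  have hA' : A ⊆ Metric.ball x η :=
    Set.sdiff_subset.trans (Metric.ball_subset_ball (min_le_right _ _))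
  have hu1 : dist u.1 (X x) ≤ ε / 2 :=
    h (convexHull_mono (Set.image_mono hA') (hfst.subset (Set.mem_image_of_mem _ hu)))
  refine ⟨u, convexHull_mono (Set.image_mono hA) hu, ?_⟩
  rw [Prod.dist_eq, dist_comm (X x)]
  exact max_lt (by linarith) hwb

/-- Filippov product rule: for `X₁, X₂` locally bounded at `x`,
`F[(X₁, X₂)](x) ⊆ F[X₁](x) × F[X₂](x)`, with equality whenever `X₁` or `X₂` is continuous
at `x`. -/
theorem filippov_product_rule {d p q : ℕ}
    (X1 : (Fin d → ℝ) → Fin p → ℝ) (X2 : (Fin d → ℝ) → Fin q → ℝ)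
    (x : Fin d → ℝ) (h1 : LocBddAt X1 x) (h2 : LocBddAt X2 x) :
    filippov (fun y => (X1 y, X2 y)) x ⊆ filippov X1 x ×ˢ filippov X2 x ∧
    ((ContinuousAt X1 x ∨ ContinuousAt X2 x) →
      filippov (fun y => (X1 y, X2 y)) x = filippov X1 x ×ˢ filippov X2 x) := by
  refine ⟨filippov_prodMk_subset X1 X2 x, fun h => (filippov_prodMk_subset X1 X2 x).antisymm ?_⟩
  rcases h with h | h
  · exact h.prod_filippov_subset X2
  · rintro ⟨v, w⟩ ⟨hv, hw⟩
    have hwv : (w, v) ∈ filippov X2 x ×ˢ filippov X1 x := ⟨hw, hv⟩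
    exact map_mem_filippov (Y := fun y => (X1 y, X2 y))
      (ContinuousLinearEquiv.prodComm ℝ (Fin q → ℝ) (Fin p → ℝ)).toContinuousLinearMap
      (fun _ => rfl) rfl (h.prod_filippov_subset X1 hwv)
end

section
/- (Filippov matrix transformation rule) Let X : ℝ^d → ℝ^m be locally bounded at x ∈ ℝ^d and let Z : ℝ^d → ℝ^{p×m} be continuous at x. Then F[Z X](x) = Z(x) F[X](x), where (Z X)(y) := Z(y) X(y) and Z(x) F[X](x) := {Z(x) v : v ∈ F[X](x)}. -/
open MeasureTheory Matrix

open Filter Topology in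
theorem filippov_subset_of_tendsto_sub {α E : Type*} [MeasureSpace α] [PseudoMetricSpace α]
    [NormedAddCommGroup E] [NormedSpace ℝ E] {f g : α → E} {x : α}
    (h : Tendsto (fun y => f y - g y) (𝓝 x) (𝓝 0)) : filippov f x ⊆ filippov g x := by
  intro w hw
  simp only [filippov, Set.mem_iInter] at hw ⊢
  intro δ hδ S hS
  rw [Metric.closure_eq_iInter_cthickening]
  simp only [Set.mem_iInter]
  intro ε hε
  obtain ⟨r, hr, hclose⟩ := Metric.tendsto_nhds_nhds.1 h ε hε
  refine closure_minimal (convexHull_min ?_ ((convex_convexHull ℝ _).cthickening ε))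
    Metric.isClosed_cthickening (hw (min r δ) (lt_min hr hδ) S hS)
  rintro _ ⟨y, ⟨hy, hyS⟩, rfl⟩
  rw [Metric.mem_ball, lt_min_iff] at hy
  refine Metric.mem_cthickening_of_dist_le _ (g y) _ _
    (subset_convexHull ℝ _ ⟨y, ⟨hy.2, hyS⟩, rfl⟩) ?_
  have hy' := hclose hy.1
  rw [dist_zero_right] at hy'
  rw [dist_eq_norm]
  exact hy'.le

open Filter Topology in
/-- The Filippov set-valued map does not see perturbations that vanish at the base point. -/
theorem filippov_eq_of_tendsto_sub {α E : Type*} [MeasureSpace α] [PseudoMetricSpace α]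
    [NormedAddCommGroup E] [NormedSpace ℝ E] {f g : α → E} {x : α}
    (h : Tendsto (fun y => f y - g y) (𝓝 x) (𝓝 0)) : filippov f x = filippov g x :=
  (filippov_subset_of_tendsto_sub h).antisymm
    (filippov_subset_of_tendsto_sub (by simpa using h.neg))

/-- The Filippov set-valued map of a locally bounded map commutes with continuous linear maps. -/
theorem filippov_continuousLinearMap_comp {α E F : Type*} [MeasureSpace α] [PseudoMetricSpace α]
    [NormedAddCommGroup E] [NormedSpace ℝ E] [ProperSpace E]
    [NormedAddCommGroup F] [NormedSpace ℝ F] (L : E →L[ℝ] F) {X : α → E} {x : α}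
    (hX : LocBddAt X x) : filippov (fun y => L (X y)) x = L '' filippov X x := by
  have himage (A : Set α) :
      convexHull ℝ ((fun y => L (X y)) '' A) = L '' convexHull ℝ (X '' A) := by
    rw [← Set.image_image L X A]
    exact (L.toLinearMap.image_convexHull _).symm
  refine Set.Subset.antisymm ?_ ?_
  · intro w hw
    obtain ⟨δ₀, hδ₀, C, hC⟩ := hX
    let ι := {q : ℝ × Set α // (0 < q.1 ∧ q.1 ≤ δ₀) ∧ volume q.2 = 0}
    let K : ι → Set E := fun q => closure (convexHull ℝ (X '' (Metric.ball x q.1.1 \ q.1.2)))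
    have hKcompact (q : ι) : IsCompact (K q) := by
      refine (isCompact_closedBall (0 : E) C).of_isClosed_subset isClosed_closure
        (closure_minimal (convexHull_min ?_ (convex_closedBall _ _)) Metric.isClosed_closedBall)
      rintro _ ⟨y, hy, rfl⟩
      exact mem_closedBall_zero_iff.2 (hC y (Metric.ball_subset_ball q.2.1.2 hy.1))
    have hfiber : IsClosed (L ⁻¹' {w}) := isClosed_singleton.preimage L.continuous
    have : Nonempty ι := ⟨⟨(δ₀, ∅), ⟨hδ₀, le_rfl⟩, measure_empty⟩⟩
    obtain ⟨v, hv⟩ := IsCompact.nonempty_iInter_of_directed_nonempty_isCompact_isClosed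
      (fun q : ι => K q ∩ L ⁻¹' {w}) (by
        rintro ⟨⟨r, S⟩, hr, hS⟩ ⟨⟨s, T⟩, hs, hT⟩
        refine ⟨⟨(min r s, S ∪ T), ⟨lt_min hr.1 hs.1, (min_le_left _ _).trans hr.2⟩,
          measure_union_null hS hT⟩, ?_, ?_⟩
        · exact Set.inter_subset_inter_left _ (closure_mono (convexHull_mono (Set.image_mono
            (Set.sdiff_subset_sdiff (Metric.ball_subset_ball (min_le_left _ _))
              Set.subset_union_left))))
        · exact Set.inter_subset_inter_left _ (closure_mono (convexHull_mono (Set.image_mono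
            (Set.sdiff_subset_sdiff (Metric.ball_subset_ball (min_le_right _ _))
              Set.subset_union_right)))))
      (by
        intro q
        simp only [filippov, Set.mem_iInter] at hw
        have hwq := hw q.1.1 q.2.1.1 q.1.2 q.2.2
        rw [himage] at hwq
        exact closure_minimal (Set.image_mono subset_closure)
          ((hKcompact q).image L.continuous).isClosed hwq)
      (fun q => (hKcompact q).inter_right hfiber)
      (fun q => isClosed_closure.inter hfiber)
    rw [Set.mem_iInter] at hv
    refine ⟨v, ?_, (hv (Classical.arbitrary ι)).2⟩
    simp only [filippov, Set.mem_iInter]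
    intro δ hδ S hS
    have hvS := (hv ⟨(min δ δ₀, S), ⟨lt_min hδ hδ₀, min_le_right _ _⟩, hS⟩).1
    exact closure_mono (convexHull_mono (Set.image_mono
      (Set.sdiff_subset_sdiff_left (Metric.ball_subset_ball (min_le_left _ _))))) hvS
  · rintro _ ⟨v, hv, rfl⟩
    simp only [filippov, Set.mem_iInter] at hv ⊢
    intro δ hδ S hS
    rw [himage]
    exact image_closure_subset_closure_image L.continuous ⟨v, hv δ hδ S hS, rfl⟩

/-- Filippov matrix transformation rule: if `X` is locally bounded at `x` and `Z` is
continuous at `x`, then `F[Z X](x) = Z(x) F[X](x)`. -/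
theorem filippov_matrix_transformation_rule {d m p : ℕ}
    (X : (Fin d → ℝ) → Fin m → ℝ) (Z : (Fin d → ℝ) → Matrix (Fin p) (Fin m) ℝ)
    (x : Fin d → ℝ) (hX : LocBddAt X x) (hZ : ContinuousAt Z x) :
    filippov (fun y => (Z y).mulVec (X y)) x = (Z x).mulVec '' filippov X x := by
  rw [filippov_eq_of_tendsto_sub (g := fun y => (Z x).mulVec (X y))]
  · exact filippov_continuousLinearMap_comp (Z x).mulVecLin.toContinuousLinearMap hX
  obtain ⟨δ, hδ, C, hC⟩ := hX
  rw [tendsto_pi_nhds]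
  intro i
  simp only [← Matrix.sub_mulVec, Matrix.mulVec, dotProduct, Pi.zero_apply]
  rw [← Finset.sum_const_zero (s := (Finset.univ : Finset (Fin m)))]
  refine tendsto_finsetSum _ fun j _ => ?_
  refine Filter.Tendsto.zero_mul_isBoundedUnder_le ?_
    (Filter.isBoundedUnder_of_eventually_le (a := C) ?_)
  · have hij : ContinuousAt (fun y => Z y i j) x :=
      (continuous_apply_apply i j).continuousAt.comp hZ
    simpa using hij.tendsto.sub_const (Z x i j)
  · filter_upwards [Metric.ball_mem_nhds x hδ] with y hy
    exact (norm_le_pi_norm (X y) j).trans (hC y hy)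
end

section
/- Consider the closed-loop system ẋ = −B R B^T ∇H(x) − B ∇H_c(η) + E d̄, η̇ = B^T ∇H(x), and assume the matching condition holds with η̄. Then along every continuously differentiable solution (x(t), η(t)), the function V_d̄ satisfies d/dt V_d̄(x(t), η(t)) = −∇H(x(t))^T B R B^T ∇H(x(t)) ≤ 0. -/
open Matrix

/-- The continuous linear functional `v ↦ g ⬝ᵥ v`; used to express gradients. -/
noncomputable def dotCLM {N : ℕ} (g : Fin N → ℝ) : (Fin N → ℝ) →L[ℝ] ℝ :=
  ∑ i, g i • (ContinuousLinearMap.proj i : (Fin N → ℝ) →L[ℝ] ℝ)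

theorem dotCLM_apply {N : ℕ} (g v : Fin N → ℝ) : dotCLM g v = g ⬝ᵥ v := by
  simp [dotCLM, dotProduct]

theorem IsPosDiag.eq_diagonal {m : ℕ} {R : Matrix (Fin m) (Fin m) ℝ} (hR : IsPosDiag R) :
    R = diagonal R.diag := by
  ext i j
  by_cases h : i = j
  · subst h
    simp
  · rw [diagonal_apply_ne _ h, hR.1 i j h]

theorem IsPosDiag.posSemidef {m : ℕ} {R : Matrix (Fin m) (Fin m) ℝ} (hR : IsPosDiag R) :
    R.PosSemidef := by
  rw [hR.eq_diagonal]
  exact PosSemidef.diagonal fun i => (hR.2 i).le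

/-- Along every solution of the closed-loop system, under the matching condition, the
candidate Lyapunov function `V_d̄` satisfies
`d/dt V_d̄(x(t), η(t)) = −∇H(x(t))ᵀ B R Bᵀ ∇H(x(t)) ≤ 0`. -/
theorem lyapunov_derivative_along_solutions
    {n m k : ℕ} (tail head : Fin m → Fin n) (hloop : ∀ e, tail e ≠ head e)
    (R : Matrix (Fin m) (Fin m) ℝ) (hR : IsPosDiag R)
    (E : Matrix (Fin n) (Fin k) ℝ) (hE : IsExtMat E) (d : Fin k → ℝ)
    (H : (Fin n → ℝ) → ℝ) (gradH : (Fin n → ℝ) → Fin n → ℝ)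
    (hH : ∀ y, HasFDerivAt H (dotCLM (gradH y)) y) (hH' : Continuous gradH)
    (Hc : (Fin m → ℝ) → ℝ) (gradHc : (Fin m → ℝ) → Fin m → ℝ)
    (hHc : ∀ y, HasFDerivAt Hc (dotCLM (gradHc y)) y) (hHc' : Continuous gradHc)
    (ηbar : Fin m → ℝ)
    (hmatch : E.mulVec d = (incMat tail head).mulVec (gradHc ηbar))
    (x : ℝ → Fin n → ℝ) (η : ℝ → Fin m → ℝ)
    (hx : ∀ t, HasDerivAt x
      (-(incMat tail head * R * (incMat tail head)ᵀ).mulVec (gradH (x t))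
        - (incMat tail head).mulVec (gradHc (η t)) + E.mulVec d) t)
    (hη : ∀ t, HasDerivAt η ((incMat tail head)ᵀ.mulVec (gradH (x t))) t) :
    ∀ t : ℝ,
      HasDerivAt (fun s : ℝ =>
          H (x s) + Hc (η s) - gradHc ηbar ⬝ᵥ (η s - ηbar) - Hc ηbar)
        (-(gradH (x t) ⬝ᵥ
          (incMat tail head * R * (incMat tail head)ᵀ).mulVec (gradH (x t)))) t ∧
      -(gradH (x t) ⬝ᵥ
          (incMat tail head * R * (incMat tail head)ᵀ).mulVec (gradH (x t))) ≤ 0 := by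
  intro t
  set B := incMat tail head
  refine ⟨?_, ?_⟩
  · have hHx := (hH (x t)).comp_hasDerivAt t (hx t)
    have hHcη := (hHc (η t)).comp_hasDerivAt t (hη t)
    have hlin := (dotCLM (gradHc ηbar)).hasFDerivAt.comp_hasDerivAt t ((hη t).sub_const ηbar)
    have hV := ((hHx.add hHcη).sub hlin).sub_const (Hc ηbar)
    have transpose_pairing (u : Fin m → ℝ) (v : Fin n → ℝ) : u ⬝ᵥ Bᵀ *ᵥ v = v ⬝ᵥ B *ᵥ u := by
      rw [mulVec_transpose, dotProduct_comm, dotProduct_mulVec]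
    refine (hV.congr_deriv ?_).congr_of_eventuallyEq (.of_forall fun s => ?_)
    · simp only [dotCLM_apply, hmatch, dotProduct_add, dotProduct_sub, dotProduct_neg,
        transpose_pairing]
      ring
    · simp [dotCLM_apply]
  · have h := (hR.posSemidef.mul_mul_conjTranspose_same B).dotProduct_mulVec_nonneg (gradH (x t))
    simpa using h
end

section
/- (One step of the flow-rescaling algorithm) Let B be the incidence matrix of a directed graph, let φ ∈ ℝ^m, and let i be a vertex with B(i,:) φ < 0. Define f^{in} = {j : B_{ij} φ_j > 0}, f^{out} = {j : B_{ij} φ_j < 0}, and the ratio r = (Σ_{j ∈ f^{in}} |φ_j|) / (Σ_{j ∈ f^{out}} |φ_j|). Define the updated flow φ' by φ'_j = r φ_j for j ∈ f^{out} and φ'_j = φ_j otherwise. Then 0 ≤ r < 1, |φ'_j| ≤ |φ_j| for all j = 1, …, m, and B(i,:) φ' = 0. -/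
open Matrix

theorem abs_incMat_mul {n m : ℕ} (tail head : Fin m → Fin n) (i : Fin n) (j : Fin m) (x : ℝ)
    (h : incMat tail head i j * x ≠ 0) : |incMat tail head i j * x| = |x| := by
  simp only [incMat, Matrix.of_apply] at h ⊢
  split_ifs at h ⊢ <;> simp_all

theorem sum_eq_sum_abs_pos_sub_sum_abs_neg {ι : Type*} (s : Finset ι) (x : ι → ℝ) :
    ∑ j ∈ s, x j = ∑ j ∈ s with 0 < x j, |x j| - ∑ j ∈ s with x j < 0, |x j| := by
  rw [Finset.sum_filter, Finset.sum_filter, ← Finset.sum_sub_distrib]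
  refine Finset.sum_congr rfl fun j _ => ?_
  rcases lt_trichotomy (x j) 0 with h | h | h
  · simp [h, h.not_gt, abs_of_neg h]
  · simp [h]
  · simp [h, h.not_gt, abs_of_pos h]

/-- One step of the flow-rescaling algorithm: at a vertex `i` with net inflow
`B(i,:) φ < 0`, rescaling the flows on the outgoing edges of `i` by the ratio
`r = (Σ_{j ∈ f^in} |φ_j|)/(Σ_{j ∈ f^out} |φ_j|)` gives `0 ≤ r < 1`, does not increase any
`|φ_j|`, and achieves `B(i,:) φ' = 0`. -/
theorem flow_rescaling_step
    {n m : ℕ} (tail head : Fin m → Fin n) (hloop : ∀ e, tail e ≠ head e)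
    (φ : Fin m → ℝ) (i : Fin n)
    (hneg : incMat tail head i ⬝ᵥ φ < 0) :
    ∀ r : ℝ,
      r = (∑ j ∈ Finset.univ.filter fun j => 0 < incMat tail head i j * φ j, |φ j|) /
          (∑ j ∈ Finset.univ.filter fun j => incMat tail head i j * φ j < 0, |φ j|) →
      ∀ φ' : Fin m → ℝ,
        φ' = (fun j => if incMat tail head i j * φ j < 0 then r * φ j else φ j) →
        (0 ≤ r ∧ r < 1) ∧ (∀ j, |φ' j| ≤ |φ j|) ∧ incMat tail head i ⬝ᵥ φ' = 0 := by
  intro r hr φ' hφ'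
  set b := incMat tail head i with hb
  have hP : ∑ j with 0 < b j * φ j, |φ j| = ∑ j with 0 < b j * φ j, |b j * φ j| :=
    Finset.sum_congr rfl fun j hj =>
      (abs_incMat_mul tail head i j (φ j) (Finset.mem_filter.1 hj).2.ne').symm
  have hN : ∑ j with b j * φ j < 0, |φ j| = ∑ j with b j * φ j < 0, |b j * φ j| :=
    Finset.sum_congr rfl fun j hj =>
      (abs_incMat_mul tail head i j (φ j) (Finset.mem_filter.1 hj).2.ne).symm
  have hsum := sum_eq_sum_abs_pos_sub_sum_abs_neg Finset.univ fun j => b j * φ j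
  rw [← hP, ← hN] at hsum
  have hsum' : b ⬝ᵥ φ' = b ⬝ᵥ φ + (1 - r) * ∑ j with b j * φ j < 0, |φ j| := by
    rw [hN, Finset.sum_filter, Finset.mul_sum, dotProduct, dotProduct,
      ← Finset.sum_add_distrib, hφ']
    refine Finset.sum_congr rfl fun j _ => ?_
    by_cases h : b j * φ j < 0
    · simp only [h, if_true, abs_of_neg h]
      ring
    · simp [h]
  rw [dotProduct] at hneg hsum'
  rw [dotProduct, hsum', dotProduct]
  set P := ∑ j with 0 < b j * φ j, |φ j|
  set N := ∑ j with b j * φ j < 0, |φ j|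
  have hP0 : 0 ≤ P := Finset.sum_nonneg fun j _ => abs_nonneg _
  have hPN : P < N := by linarith
  have hN0 : 0 < N := hP0.trans_lt hPN
  have hr0 : 0 ≤ r := hr ▸ div_nonneg hP0 hN0.le
  have hr1 : r < 1 := hr ▸ (div_lt_one hN0).2 hPN
  refine ⟨⟨hr0, hr1⟩, fun j => ?_, ?_⟩
  · rw [hφ']
    dsimp only
    split_ifs
    · rw [abs_mul, abs_of_nonneg hr0]
      exact mul_le_of_le_one_left (abs_nonneg _) hr1.le
    · exact le_rfl
  · have : r * N = P := by rw [hr, div_mul_cancel₀ _ hN0.ne']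
    linarith
end
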